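/- arXiv:1310.3293 — 2 statements merged into one kernel-verified Lean document; each statement's English description precedes it below -/
import Mathlib

section
/- Let F̄_q be an algebraic closure of a finite field of characteristic p > 2. Fix d and s with 1 ≤ s ≤ d-3 and coefficients a_{d-1},...,a_{d-s} ∈ F̄_q. Let f := T^d + a_{d-1}T^{d-1} + ... + a_{d-s}T^{d-s} + B_{d-s-1}T^{d-s-1} + ... + B_1 T + B_0 viewed as a polynomial in T over F̄_q[B_{d-s-1},...,B_1,B_0]. Then the discriminant Disc(f) ∈ F̄_q[B_{d-s-1},...,B_0] is an irreducible polynomial. -/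
open Polynomial

theorem irr_abstract {L : Type*} [Field L] [IsAlgClosed L] {σ : Type*} [Finite σ]
    (D : MvPolynomial σ L) (ψ : σ → MvPolynomial σ L)
    (hV : ∀ b : σ → L, MvPolynomial.eval b D = 0 ↔
      ∃ θ : σ → L, b = fun i => MvPolynomial.eval θ (ψ i))
    (b₀ : σ → L) (hb₀ : MvPolynomial.eval b₀ D = 0)
    (φ : MvPolynomial σ L →+* L[X])
    (hφ : ∀ A, (φ A).eval 0 = MvPolynomial.eval b₀ A)
    (hX : ¬ X ^ 2 ∣ φ D) : Irreducible D := by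
  have hcomp : ∀ (θ : σ → L) (A : MvPolynomial σ L),
      MvPolynomial.eval θ (MvPolynomial.aeval ψ A) =
        MvPolynomial.eval (fun i => MvPolynomial.eval θ (ψ i)) A := by
    intro θ A
    induction A using MvPolynomial.induction_on with
    | C a => simp
    | add p q hp hq => rw [map_add, map_add, map_add, hp, hq]
    | mul_X p i hp => rw [map_mul, map_mul, map_mul, hp, MvPolynomial.aeval_X, MvPolynomial.eval_X]
  have hD0 : D ≠ 0 := by
    rintro rfl
    simp at hX
  have hDker : MvPolynomial.aeval ψ D = 0 := by
    apply MvPolynomial.funext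
    intro θ
    rw [hcomp, map_zero, hV]
    exact ⟨θ, rfl⟩
  let Q : Ideal (MvPolynomial σ L) := RingHom.ker (MvPolynomial.aeval ψ : MvPolynomial σ L →ₐ[L] MvPolynomial σ L)
  have hQ : ∀ A, A ∈ Q ↔ MvPolynomial.aeval ψ A = 0 := fun A => RingHom.mem_ker
  have hQp : Q.IsPrime := RingHom.ker_isPrime _
  have key : ∀ A P : MvPolynomial σ L, A ∈ Q → Prime P → P ∣ D → P ∣ A := by
    intro A P hA hP hPD
    have : (Ideal.span {P}).IsPrime := (Ideal.span_singleton_prime hP.ne_zero).2 hP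
    rw [← Ideal.mem_span_singleton, ← MvPolynomial.IsPrime.vanishingIdeal_zeroLocus (K := L) (Ideal.span {P})]
    rw [MvPolynomial.mem_vanishingIdeal_iff]
    intro b hb
    have h1 : MvPolynomial.eval b P = 0 := by
      have := hb P (Ideal.mem_span_singleton_self P)
      simpa [MvPolynomial.aeval_eq_eval] using this
    have h2 : MvPolynomial.eval b D = 0 := by
      obtain ⟨E, rfl⟩ := hPD
      simp [h1]
    obtain ⟨θ, rfl⟩ := (hV b).1 h2
    have := hcomp θ A
    rw [(hQ A).1 hA] at this
    simpa [MvPolynomial.aeval_eq_eval] using this.symm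
  have main : ∀ A B : MvPolynomial σ L, D = A * B → A ∈ Q → IsUnit B := by
    intro A B hAB hA
    by_contra hB
    have hB0 : B ≠ 0 := by
      rintro rfl
      exact hD0 (by simpa using hAB)
    obtain ⟨P, hPirr, hPB⟩ := WfDvdMonoid.exists_irreducible_factor hB hB0
    have hP := hPirr.prime
    have hPD : P ∣ D := hAB ▸ hPB.mul_left A
    have hPA := key A P hA hP hPD
    have hPQ : P ∈ Q := by
      obtain ⟨P0, hP0, hP0p⟩ := hQp.exists_mem_prime_of_ne_bot
        (fun h => hD0 (by simpa [h] using (hQ D).2 hDker))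
      have h1 := key P0 P hP0 hP hPD
      have h2 := hP.associated_of_dvd hP0p h1
      exact Ideal.mem_of_dvd _ h2.symm.dvd hP0
    obtain ⟨θ, hθ⟩ := (hV b₀).1 hb₀
    have h3 : MvPolynomial.eval b₀ P = 0 := by
      rw [hθ, ← hcomp, (hQ P).1 hPQ, map_zero]
    have h4 : X ∣ φ P := by
      rw [X_dvd_iff, coeff_zero_eq_eval_zero, hφ, h3]
    apply hX
    obtain ⟨A', rfl⟩ := hPA
    obtain ⟨B', rfl⟩ := hPB
    obtain ⟨P', hP'⟩ := h4
    refine ⟨P' ^ 2 * (φ A' * φ B'), ?_⟩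
    rw [hAB, φ.map_mul, φ.map_mul, φ.map_mul, hP']
    ring
  refine ⟨fun h => ?_, fun {A B} hAB => ?_⟩
  · have := h.map (MvPolynomial.eval b₀)
    rw [hb₀] at this
    exact not_isUnit_zero this
  · have := (hQ D).2 hDker
    rw [hAB] at this
    rcases hQp.mem_or_mem this with h | h
    · exact Or.inr (main A B hAB h)
    · exact Or.inl (main B A (by rw [hAB, mul_comm]) h)

theorem prod_swap {L : Type*} [Field L] [IsAlgClosed L] (f : L[X]) (hf : f.Monic) (ε : L) :
    ((f + C ε).roots.map fun r => (derivative (f + C ε)).eval r).prod =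
      if f.natDegree = 0 then 1 else
      (-1) ^ (f.natDegree * (derivative f).natDegree) *
      ((derivative f).leadingCoeff ^ f.natDegree *
        ((derivative f).roots.map fun r => f.eval r + ε).prod) := by
  split_ifs with h0
  · rw [hf.natDegree_eq_zero.1 h0, ← C_1, ← C_add, roots_C]; simp
  have hdeg : (f + C ε).natDegree = f.natDegree := natDegree_add_C
  have hm : (f + C ε).Monic := by
    rw [Monic, leadingCoeff, hdeg, coeff_add, coeff_C_of_ne_zero h0]
    rw [add_zero]; exact hf
  have hder : derivative (f + C ε) = derivative f := by simp
  have h1 := resultant_eq_prod_eval (f + C ε) (derivative f) (derivative f).natDegree le_rfl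
    (IsAlgClosed.splits _)
  have h2 := resultant_eq_prod_eval (derivative f) (f + C ε) (f + C ε).natDegree le_rfl
    (IsAlgClosed.splits _)
  rw [resultant_comm, h2, hm.leadingCoeff, one_pow, one_mul, hdeg] at h1
  rw [hder]
  rw [← h1]
  simp

theorem exists_good {L : Type*} [Field L] [IsAlgClosed L] (h2 : (2 : L) ≠ 0)
    (d : ℕ) (hd : 4 ≤ d) (G : L[X]) (hG : G.Monic) (hGd : G.natDegree = d) :
    ∃ (r c0 c1 c2 : L) (g : L[X]), G + (C c0 + C c1 * X + C c2 * X ^ 2) = (X - C r) ^ 2 * g ∧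
      g.eval r ≠ 0 ∧ ∀ x, g.eval x = 0 → g.derivative.eval x ≠ 0 := by
  set r : L := (1 - G.coeff (d - 1)) / 2 with hr
  set q : L[X] := (X - C r) ^ 2 with hq
  have hqm : q.Monic := (monic_X_sub_C r).pow 2
  have hqd : q.natDegree = 2 := by simp [hq, natDegree_pow]
  set h : L[X] := G /ₘ q with hh
  have hmod : G %ₘ q + q * h = G := modByMonic_add_div G q
  have hrem : (G %ₘ q).natDegree < 2 := by
    have := natDegree_modByMonic_lt G hqm (by intro h; rw [h] at hqd; simp at hqd)
    omega
  have hhd : h.natDegree = d - 2 := by rw [hh, natDegree_divByMonic G hqm, hqd, hGd]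
  have hhm : h.coeff (d - 2) = 1 := by
    have := leadingCoeff_divByMonic_of_monic hqm
      (show q.degree ≤ G.degree by
        rw [degree_eq_natDegree hqm.ne_zero, degree_eq_natDegree hG.ne_zero, hqd, hGd]
        exact_mod_cast (by omega : 2 ≤ d))
    rw [hG.leadingCoeff, leadingCoeff, ← hh, hhd] at this
    exact this
  obtain ⟨e, rfl⟩ : ∃ e, d = e + 4 := ⟨d - 4, by omega⟩
  have hc : h.coeff (e + 1) = 1 := by
    have h1 : G.coeff (e + 3) = h.coeff (e + 1) - 2 * r * h.coeff (e + 2) + r ^ 2 * h.coeff (e + 3) := by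
      conv_lhs => rw [← hmod]
      rw [coeff_add, coeff_eq_zero_of_natDegree_lt (p := G %ₘ q) (by omega)]
      have : q * h = h * X ^ 2 - C (2 * r) * (h * X) + C (r ^ 2) * h := by
        rw [hq]; simp only [map_mul, map_pow, C_ofNat]; ring
      rw [this, coeff_add, coeff_sub, coeff_C_mul, coeff_C_mul, coeff_mul_X_pow, coeff_mul_X]
      ring
    have h3 : h.coeff (e + 3) = 0 := coeff_eq_zero_of_natDegree_lt (by omega)
    have h4 : h.coeff (e + 2) = 1 := hhm
    rw [h3, h4] at h1
    have h5 : 2 * r = 1 - G.coeff (e + 3) := by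
      rw [hr, mul_div_cancel₀ _ h2]; rfl
    linear_combination h5 - h1
  have hder : derivative h ≠ 0 := by
    intro h0
    have e1 : (derivative h).coeff (e + 1) = 0 := by simp [h0]
    have e2 : (derivative h).coeff e = 0 := by simp [h0]
    rw [coeff_derivative] at e1 e2
    have h4 : h.coeff (e + 1 + 1) = 1 := hhm
    rw [h4] at e1; rw [hc] at e2
    push_cast at e1
    have : (1 : L) = 0 := by linear_combination e1 - e2
    exact one_ne_zero this
  classical
  obtain ⟨c, hcn⟩ := Infinite.exists_notMem_finset
    (insert (-(h.eval r)) ((derivative h).roots.toFinset.image fun x => -(h.eval x)))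
  simp only [Finset.mem_insert, Finset.mem_image, Multiset.mem_toFinset, not_or, not_exists,
    not_and] at hcn
  obtain ⟨hc1, hc2⟩ := hcn
  have hlin : G %ₘ q = C ((G %ₘ q).coeff 1) * X + C ((G %ₘ q).coeff 0) :=
    eq_X_add_C_of_natDegree_le_one (by omega)
  refine ⟨r, c * r ^ 2 - (G %ₘ q).coeff 0, - 2 * r * c - (G %ₘ q).coeff 1, c, h + C c, ?_, ?_, ?_⟩
  · rw [← hq, mul_add]
    have h6 : q * h = G - (C ((G %ₘ q).coeff 1) * X + C ((G %ₘ q).coeff 0)) := by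
      rw [← hlin]; exact eq_sub_of_add_eq' hmod
    rw [h6, hq]
    simp only [map_mul, map_pow, map_sub, map_neg, C_ofNat]
    ring
  · intro h0
    apply hc1
    simp at h0
    linear_combination h0
  · intro x hx hx'
    simp at hx hx'
    refine hc2 x ?_ ?_
    · rw [mem_roots hder]; exact hx'
    · linear_combination -hx

theorem general {L : Type*} [Field L] [IsAlgClosed L] (h2 : (2 : L) ≠ 0)
    (d n : ℕ) (hn : 3 ≤ n) (hnd : n < d) (G : L[X]) (hG : G.Monic) (hGd : G.natDegree = d)
    (f : (Fin n → L) → L[X])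
    (hf : ∀ b, f b = G + ∑ i : Fin n, C (b i) * X ^ (i : ℕ))
    (D : MvPolynomial (Fin n) L) (u : L) (hu : u ≠ 0)
    (hD : ∀ b : Fin n → L, MvPolynomial.eval b D =
        u * ((f b).roots.map fun r => (derivative (f b)).eval r).prod) :
    Irreducible D := by
  obtain ⟨m, rfl⟩ : ∃ m, n = m + 3 := ⟨n - 3, by omega⟩
  have hsum : ∀ b : Fin (m + 3) → L,
      (∑ i : Fin (m + 3), C (b i) * X ^ (i : ℕ) : L[X]).degree < d := by
    intro b
    apply lt_of_le_of_lt (degree_sum_fin_lt b).le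
    exact_mod_cast hnd
  have hmon : ∀ b, (f b).Monic := by
    intro b
    rw [hf]
    apply hG.add_of_left
    rw [degree_eq_natDegree hG.ne_zero, hGd]
    exact hsum b
  have hdeg : ∀ b, (f b).natDegree = d := by
    intro b
    rw [hf, natDegree_add_eq_left_of_degree_lt, hGd]
    rw [degree_eq_natDegree hG.ne_zero, hGd]
    exact hsum b
  have hf' : ∀ b, f b = G + (C (b 0) + (C (b 1) * X +
      ∑ i : Fin (m + 1), C (b i.succ.succ) * X ^ ((i : ℕ) + 2))) := by
    intro b
    rw [hf, Fin.sum_univ_succ, Fin.sum_univ_succ]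
    simp
  have hD0 : ∀ b, MvPolynomial.eval b D = 0 ↔
      ∃ r, (f b).eval r = 0 ∧ (derivative (f b)).eval r = 0 := by
    intro b
    rw [hD]
    simp only [mul_eq_zero, hu, false_or, Multiset.prod_eq_zero_iff, Multiset.mem_map,
      mem_roots (hmon b).ne_zero, IsRoot.def]
  let S : MvPolynomial (Fin (m + 3)) L := ∑ i : Fin (m + 1),
    MvPolynomial.X i.succ.succ * MvPolynomial.X 0 ^ ((i : ℕ) + 2)
  let S' : MvPolynomial (Fin (m + 3)) L := ∑ i : Fin (m + 1),
    MvPolynomial.X i.succ.succ * (MvPolynomial.C ((i : ℕ) + 2 : L) *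
      MvPolynomial.X 0 ^ ((i : ℕ) + 1))
  let ψ1 : MvPolynomial (Fin (m + 3)) L :=
    -((derivative G).eval₂ MvPolynomial.C (MvPolynomial.X 0) + S')
  let ψ0 : MvPolynomial (Fin (m + 3)) L :=
    -(G.eval₂ MvPolynomial.C (MvPolynomial.X 0) + S) - ψ1 * MvPolynomial.X 0
  let ψ : Fin (m + 3) → MvPolynomial (Fin (m + 3)) L :=
    Fin.cons ψ0 (Fin.cons ψ1 (fun i : Fin (m + 1) => MvPolynomial.X i.succ.succ))
  have hev : ∀ (P : L[X]) (θ : Fin (m + 3) → L),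
      MvPolynomial.eval θ (P.eval₂ MvPolynomial.C (MvPolynomial.X 0)) = P.eval (θ 0) := by
    intro P θ
    rw [hom_eval₂, MvPolynomial.eval_X]
    have : (MvPolynomial.eval θ).comp MvPolynomial.C = RingHom.id L := by ext; simp
    rw [this, eval₂_id]
  have hS : ∀ θ : Fin (m + 3) → L, MvPolynomial.eval θ S =
      ∑ i : Fin (m + 1), θ i.succ.succ * θ 0 ^ ((i : ℕ) + 2) := by
    intro θ; simp [S]
  have hS' : ∀ θ : Fin (m + 3) → L, MvPolynomial.eval θ S' =
      ∑ i : Fin (m + 1), θ i.succ.succ * (((i : ℕ) + 2 : L) * θ 0 ^ ((i : ℕ) + 1)) := by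
    intro θ; simp [S']
  have hψ1 : ∀ θ, MvPolynomial.eval θ ψ1 = -((derivative G).eval (θ 0) +
      ∑ i : Fin (m + 1), θ i.succ.succ * (((i : ℕ) + 2 : L) * θ 0 ^ ((i : ℕ) + 1))) := by
    intro θ
    rw [← hS', ← hev, ← map_add, ← map_neg]
  have hψ0 : ∀ θ, MvPolynomial.eval θ ψ0 = -(G.eval (θ 0) +
      ∑ i : Fin (m + 1), θ i.succ.succ * θ 0 ^ ((i : ℕ) + 2))
        - MvPolynomial.eval θ ψ1 * θ 0 := by
    intro θ
    rw [← hS, ← hev, ← map_add, ← map_neg, map_sub, map_mul, MvPolynomial.eval_X]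
  have hfe : ∀ b r, (f b).eval r = G.eval r + (b 0 + (b 1 * r +
      ∑ i : Fin (m + 1), b i.succ.succ * r ^ ((i : ℕ) + 2))) := by
    intro b r
    rw [hf']
    simp [eval_finsetSum]
  have hfe' : ∀ b r, (derivative (f b)).eval r = (derivative G).eval r + (b 1 +
      ∑ i : Fin (m + 1), b i.succ.succ * (((i : ℕ) + 2 : L) * r ^ ((i : ℕ) + 1))) := by
    intro b r
    rw [hf']
    simp [eval_finsetSum]
    refine Finset.sum_congr rfl fun x _ => ?_
    ring
  have hV : ∀ b : Fin (m + 3) → L, MvPolynomial.eval b D = 0 ↔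
      ∃ θ : Fin (m + 3) → L, b = fun i => MvPolynomial.eval θ (ψ i) := by
    intro b
    rw [hD0]
    constructor
    · rintro ⟨r, hr, hr'⟩
      rw [hfe] at hr
      rw [hfe'] at hr'
      let θ : Fin (m + 3) → L := Fin.cons r (fun i : Fin (m + 2) => b i.succ)
      have hθ0 : θ 0 = r := rfl
      have hθs : ∀ i : Fin (m + 1), θ i.succ.succ = b i.succ.succ := fun i => rfl
      have e1 : b 1 = MvPolynomial.eval θ ψ1 := by
        rw [hψ1]
        simp only [hθ0, hθs]
        linear_combination hr'
      have e0 : b 0 = MvPolynomial.eval θ ψ0 := by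
        rw [hψ0, ← e1]
        simp only [hθ0, hθs]
        linear_combination hr
      refine ⟨θ, ?_⟩
      funext i
      refine Fin.cases ?_ (fun j => Fin.cases ?_ (fun k => ?_) j) i
      · exact e0
      · exact e1
      · change b k.succ.succ = MvPolynomial.eval θ (MvPolynomial.X k.succ.succ)
        rw [MvPolynomial.eval_X, hθs]
    · rintro ⟨θ, hb⟩
      have e0 : b 0 = MvPolynomial.eval θ ψ0 := by rw [hb]; rfl
      have e1 : b 1 = MvPolynomial.eval θ ψ1 := by rw [hb]; rfl
      have es : ∀ i : Fin (m + 1), b i.succ.succ = θ i.succ.succ := by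
        intro i
        rw [hb]
        change MvPolynomial.eval θ (MvPolynomial.X i.succ.succ) = _
        rw [MvPolynomial.eval_X]
      refine ⟨θ 0, ?_, ?_⟩
      · rw [hfe, e0, e1, hψ0]
        simp only [es]
        ring
      · rw [hfe', e1, hψ1]
        simp only [es]
        ring
  obtain ⟨r, c0, c1, c2, g, hg, hgr, hgx⟩ := exists_good h2 d (by omega) G hG hGd
  let b₀ : Fin (m + 3) → L := Fin.cons c0 (Fin.cons c1 (Fin.cons c2 0))
  have hfb₀ : f b₀ = (X - C r) ^ 2 * g := by
    rw [← hg, hf', Fin.sum_univ_succ]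
    have a0 : b₀ 0 = c0 := rfl
    have a1 : b₀ 1 = c1 := rfl
    have a2 : b₀ (Fin.succ (Fin.succ 0)) = c2 := rfl
    have a3 : ∀ i : Fin m, b₀ i.succ.succ.succ = 0 := fun i => rfl
    rw [a0, a1, a2]
    simp only [a3]
    simp
    ring
  have hder : derivative (f b₀) = (X - C r) * (2 * g + (X - C r) * derivative g) := by
    rw [hfb₀, derivative_mul, sq, derivative_mul]
    simp only [derivative_sub, derivative_X, derivative_C]
    ring
  have hder2 : (2 * g + (X - C r) * derivative g).eval r ≠ 0 := by
    simp [h2, hgr]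
  have hk0 : 2 * g + (X - C r) * derivative g ≠ 0 := by
    intro h; rw [h] at hder2; simp at hder2
  have hder0 : derivative (f b₀) ≠ 0 := by
    rw [hder]; exact mul_ne_zero (X_sub_C_ne_zero r) hk0
  have hroots : (derivative (f b₀)).roots =
      r ::ₘ (2 * g + (X - C r) * derivative g).roots := by
    rw [hder, roots_mul (by rw [← hder]; exact hder0), roots_X_sub_C, Multiset.singleton_add]
  have hM : ∀ x ∈ (2 * g + (X - C r) * derivative g).roots, (f b₀).eval x ≠ 0 := by
    intro x hx h0
    rw [mem_roots hk0, IsRoot.def] at hx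
    by_cases hxr : x = r
    · subst hxr; exact hder2 hx
    · have hxr' : x - r ≠ 0 := sub_ne_zero.2 hxr
      have hgx0 : g.eval x = 0 := by
        rw [hfb₀] at h0
        simpa [hxr'] using h0
      apply hgx x hgx0
      simpa [hgx0, hxr'] using hx
  have hfr : (f b₀).eval r = 0 := by rw [hfb₀]; simp
  let φ : MvPolynomial (Fin (m + 3)) L →+* L[X] :=
    MvPolynomial.eval₂Hom C (fun i => C (b₀ i) + if i = 0 then X else 0)
  have hφε : ∀ A ε, (φ A).eval ε =
      MvPolynomial.eval (fun i => b₀ i + if i = 0 then ε else 0) A := by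
    intro A ε
    induction A using MvPolynomial.induction_on with
    | C a => simp [φ]
    | add p q hp hq => rw [map_add, eval_add, hp, hq, map_add]
    | mul_X p i hp =>
      rw [map_mul, eval_mul, hp, map_mul, MvPolynomial.eval_X]
      congr 1
      simp only [φ, MvPolynomial.eval₂Hom_X', eval_add, eval_C]
      split_ifs <;> simp
  have hfε : ∀ ε, f (fun i => b₀ i + if i = 0 then ε else 0) = f b₀ + C ε := by
    intro ε
    rw [hf', hf']
    simp [Fin.succ_ne_zero]
    ring
  let v : L := u * ((-1) ^ (d * (derivative (f b₀)).natDegree) *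
      (derivative (f b₀)).leadingCoeff ^ d)
  have hv : v ≠ 0 := by
    refine mul_ne_zero hu (mul_ne_zero (pow_ne_zero _ (by simp)) (pow_ne_zero _ ?_))
    simpa using hder0
  let W : L[X] := ((2 * g + (X - C r) * derivative g).roots.map
    fun x => C ((f b₀).eval x) + X).prod
  have hφD : φ D = X * (C v * W) := by
    apply Polynomial.funext
    intro ε
    rw [hφε, hD, hfε, prod_swap _ (hmon b₀), hdeg, if_neg (by omega), hroots,
      Multiset.map_cons, Multiset.prod_cons, hfr]
    have hW : W.eval ε = ((2 * g + (X - C r) * derivative g).roots.map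
        fun x => (f b₀).eval x + ε).prod := by
      simp only [W, eval_multiset_prod, Multiset.map_map, Function.comp_def, eval_add, eval_C,
        eval_X]
    rw [eval_mul, eval_mul, eval_X, eval_C, hW]
    simp only [v]
    ring
  refine irr_abstract D ψ hV b₀ ?_ φ ?_ ?_
  · rw [hD0]
    refine ⟨r, hfr, ?_⟩
    rw [hder]; simp
  · intro A
    rw [hφε]
    simp
  · rw [hφD, sq]
    intro h
    have h1 : X ∣ C v * W := (mul_dvd_mul_iff_left X_ne_zero).1 h
    rw [X_dvd_iff, coeff_zero_eq_eval_zero, eval_mul, eval_C] at h1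
    have h3 := (mul_eq_zero.1 h1).resolve_left hv
    simp only [W, eval_multiset_prod, Multiset.map_map, Function.comp_def, eval_add, eval_C,
        eval_X, add_zero, Multiset.prod_eq_zero_iff, Multiset.mem_map] at h3
    obtain ⟨x, hx, hx0⟩ := h3
    exact hM x hx hx0

/-- Let `L` be an algebraic closure of a finite field of characteristic
`p > 2` (i.e. `L` is algebraically closed, of characteristic `p`, and algebraic over its
prime field).  Fix `d, s` with `1 ≤ s ≤ d - 3` and coefficients `a_{d-1}, …, a_{d-s} ∈ L`,
and let `f_b := T^d + a_{d-1}T^{d-1} + ⋯ + a_{d-s}T^{d-s} + b_{d-s-1}T^{d-s-1} + ⋯ + b_0`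
for `b ∈ L^{d-s}`.  Then the discriminant `Disc(f) ∈ L[B_{d-s-1},…,B_0]`, characterized as
the polynomial `D` whose value at every specialization `b` is the discriminant
`(-1)^{d(d-1)/2} ∏_{f_b(r)=0} f_b'(r)` of `f_b`, is irreducible. -/
theorem stmt_7 {L : Type*} [Field L] [IsAlgClosed L] (p : ℕ) [Fact p.Prime] [CharP L p]
    [Algebra (ZMod p) L] (halg : Algebra.IsAlgebraic (ZMod p) L) (hp : 2 < p)
    (d s : ℕ) (hs : 1 ≤ s) (hsd : s + 3 ≤ d) (a : Fin s → L)
    (f : (Fin (d - s) → L) → Polynomial L)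
    (hf : ∀ b, f b = X ^ d + (∑ j : Fin s, C (a j) * X ^ (d - 1 - (j : ℕ)))
        + ∑ i : Fin (d - s), C (b i) * X ^ (i : ℕ))
    (D : MvPolynomial (Fin (d - s)) L)
    (hD : ∀ b : Fin (d - s) → L,
      MvPolynomial.eval b D =
        (-1 : L) ^ (d * (d - 1) / 2) *
          ((f b).roots.map fun r => (Polynomial.derivative (f b)).eval r).prod) :
    Irreducible D := by
  have h2 : (2 : L) ≠ 0 := by
    intro h
    have : ((2 : ℕ) : L) = 0 := by exact_mod_cast h
    rw [CharP.cast_eq_zero_iff L p] at this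
    exact absurd (Nat.le_of_dvd (by norm_num) this) (by omega)
  have hlt : (∑ j : Fin s, C (a j) * X ^ (d - 1 - (j : ℕ)) : L[X]).degree < (X ^ d : L[X]).degree := by
    rw [degree_X_pow]
    apply lt_of_le_of_lt (degree_sum_le _ _)
    rw [Finset.sup_lt_iff (by exact WithBot.bot_lt_coe _)]
    intro j _
    apply lt_of_le_of_lt (degree_C_mul_X_pow_le _ _)
    exact_mod_cast (by omega : d - 1 - (j : ℕ) < d)
  refine general h2 d (d - s) (by omega) (by omega)
    (X ^ d + ∑ j : Fin s, C (a j) * X ^ (d - 1 - (j : ℕ)))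
    ((monic_X_pow d).add_of_left hlt) ?_ f hf D ((-1) ^ (d * (d - 1) / 2))
    (pow_ne_zero _ (by simp)) hD
  rw [natDegree_add_eq_left_of_degree_lt hlt, natDegree_X_pow]
end

section
/- Let K be an algebraically closed field and consider, for d-s+1 ≤ r ≤ d, the polynomials G_i := Δ^{i-1}F(B_0, T_1,...,T_i) for 1 ≤ i ≤ r, where F := T^d + Σ_{i=d-s}^{d-1} a_i T^i + Σ_{i=1}^{d-s-1} B_i T^i + B_0 and Δ^{i-1} denotes divided differences in T. Then G_1,...,G_r form a regular sequence in K[B_{d-s-1},...,B_0, T_1,...,T_r], and the affine variety they define is equidimensional of dimension d-s. -/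
open Polynomial MvPolynomial

/-- A family `Δ i` of multivariate polynomials (in variables `X_0, …, X_i`) is the family of
divided differences of a univariate polynomial `f`:
`Δ^0 f = f(X_0)` and `(X_i - X_{i+1}) · Δ^{i+1} f = Δ^i f(X_0,…,X_i) - Δ^i f(X_0,…,X_{i-1},X_{i+1})`
(the division is exact, so this recursion characterizes the polynomials `Δ^i f`). -/
def IsDividedDifferenceFamily {R : Type*} [CommRing R] (f : Polynomial R)
    (Δ : (i : ℕ) → MvPolynomial (Fin (i + 1)) R) : Prop :=
  Δ 0 = Polynomial.aeval (MvPolynomial.X (0 : Fin 1)) f ∧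
  ∀ i : ℕ,
    (MvPolynomial.X ((Fin.last i).castSucc) - MvPolynomial.X (Fin.last (i + 1))) * Δ (i + 1) =
      MvPolynomial.rename Fin.castSucc (Δ i) -
        MvPolynomial.rename
          (fun j : Fin (i + 1) => if j = Fin.last i then Fin.last (i + 1) else j.castSucc) (Δ i)


theorem krull_aux {A S : Type*} [CommRing A] [IsDomain A] [CommRing S] [Algebra A S]
    [Algebra.IsIntegral A S] (hinj : Function.Injective (algebraMap A S)) [IsDomain S] :
    ringKrullDim S = ringKrullDim A := by
  apply le_antisymm
  · refine Order.krullDim_le_of_strictMono (PrimeSpectrum.comap (algebraMap A S)) ?_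
    intro P Q h
    exact Ideal.IsIntegral.comap_lt_comap (R := A) (I := P.asIdeal) (J := Q.asIdeal) h
  · refine iSup_le fun l => ?_
    have : FaithfulSMul A S := (faithfulSMul_iff_algebraMap_injective A S).mpr hinj
    obtain ⟨P, hP⟩ := Algebra.IsIntegral.comap_surjective A S l.head
    have : P.asIdeal.LiesOver (RelSeries.head l).asIdeal := ⟨by rw [← hP]; rfl⟩
    obtain ⟨L, hL, -⟩ := Ideal.exists_ltSeries_of_hasGoingUp l P.asIdeal
    rw [← hL]
    exact le_iSup (fun l : LTSeries (PrimeSpectrum S) => ((l.length : ℕ∞) : WithBot ℕ∞)) L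

theorem dim_aux {A S : Type*} [CommRing A] [IsDomain A] [CommRing S] [Algebra A S]
    (I : Ideal S) [Module.Free A (S ⧸ I)] [Module.Finite A (S ⧸ I)] 
    (p : Ideal S) (hp : p ∈ I.minimalPrimes) : ringKrullDim (S ⧸ p) = ringKrullDim A := by
  have hpp : p.IsPrime := hp.1.1
  have hIp : I ≤ p := hp.1.2
  have : Algebra.IsIntegral A (S ⧸ p) := by
    have h1 : Algebra.IsIntegral A (S ⧸ I) := inferInstance
    exact Algebra.IsIntegral.of_surjective (Ideal.Quotient.factorₐ A hIp)
      (Ideal.Quotient.factor_surjective hIp)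
  refine krull_aux ?_
  rw [injective_iff_map_eq_zero]
  intro a ha
  by_contra hne
  have ha' : algebraMap A S a ∈ p := Ideal.Quotient.eq_zero_iff_mem.1 ha
  clear ha
  rw [Ideal.minimalPrimes_eq_comap] at hp
  obtain ⟨q, hq, rfl⟩ := hp
  have h2 : algebraMap A (S ⧸ I) a ∈ q := ha'
  refine notMem_nonZeroDivisors_of_mem_mem_minimalPrimes h2 hq ?_
  rw [mem_nonZeroDivisors_iff_right]
  intro x hx
  rw [mul_comm, ← Algebra.smul_def] at hx
  exact (smul_eq_zero_iff_right hne).1 hx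

theorem dd_aux {A : Type*} [CommRing A] [IsDomain A] (F : Polynomial A) (hF : F.Monic)
    (D : (i : ℕ) → MvPolynomial (Fin (i + 1)) A)
    (h0 : D 0 = Polynomial.aeval (MvPolynomial.X (0 : Fin 1)) F)
    (h1 : ∀ i : ℕ,
    (MvPolynomial.X ((Fin.last i).castSucc) - MvPolynomial.X (Fin.last (i + 1))) * D (i + 1) =
      MvPolynomial.rename Fin.castSucc (D i) -
        MvPolynomial.rename
          (fun j : Fin (i + 1) => if j = Fin.last i then Fin.last (i + 1) else j.castSucc) (D i))
    (i : ℕ) (hi : i < F.natDegree) :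
    ∃ P : Polynomial (MvPolynomial (Fin i) A), P.Monic ∧ P.natDegree = F.natDegree - i ∧
      D i = P.eval₂ (rename Fin.castSucc : _ →ₐ[A] MvPolynomial (Fin (i+1)) A).toRingHom
        (X (Fin.last i)) := by
  induction i with
  | zero =>
    refine ⟨F.map MvPolynomial.C, hF.map _, by simp [hF.natDegree_map], ?_⟩
    rw [h0, Polynomial.eval₂_map, Polynomial.aeval_def]
    congr 1
    ext <;> simp [MvPolynomial.algebraMap_eq]
  | succ i ih =>
    obtain ⟨P, hP, hd, hD⟩ := ih (by omega)
    set P' := P.map (rename Fin.castSucc : _ →ₐ[A] MvPolynomial (Fin (i+1)) A).toRingHom with hP'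
    have hdd : P'.natDegree = F.natDegree - i := by rw [hP.natDegree_map, hd]
    have hm' : P'.Monic := hP.map _
    refine ⟨P' /ₘ (Polynomial.X - Polynomial.C (X (Fin.last i))), ?_, ?_, ?_⟩
    · rw [Polynomial.Monic, Polynomial.leadingCoeff_divByMonic_X_sub_C]
      · exact hm'
      · intro h
        have := Polynomial.natDegree_eq_zero_iff_degree_le_zero.2 h.le
        omega
    · rw [Polynomial.natDegree_divByMonic _ (Polynomial.monic_X_sub_C _), hdd,
        Polynomial.natDegree_X_sub_C]
      omega
    · have hne : (MvPolynomial.X ((Fin.last i).castSucc) - MvPolynomial.X (Fin.last (i + 1)) :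
          MvPolynomial (Fin (i+2)) A) ≠ 0 := by
        rw [sub_ne_zero]
        intro h
        have := MvPolynomial.X_injective h
        exact absurd this (Fin.castSucc_lt_last _).ne
      apply mul_left_cancel₀ hne
      rw [h1 i]
      have key := Polynomial.modByMonic_add_div P' (Polynomial.X - Polynomial.C (X (Fin.last i)))
      rw [Polynomial.modByMonic_X_sub_C_eq_C_eval] at key
      have k2 := congrArg (Polynomial.eval₂ (rename Fin.castSucc : _ →ₐ[A] MvPolynomial (Fin (i+2)) A).toRingHom (X (Fin.last (i+1)))) key
      rw [Polynomial.eval₂_add, Polynomial.eval₂_mul, Polynomial.eval₂_sub, Polynomial.eval₂_C, Polynomial.eval₂_C, Polynomial.eval₂_X] at k2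
      have e1 : P'.eval (X (Fin.last i)) = D i := by
        rw [hD, hP', Polynomial.eval_map]
      have e2 : rename (fun j : Fin (i + 1) => if j = Fin.last i then Fin.last (i + 1) else j.castSucc) (D i) = Polynomial.eval₂ (rename Fin.castSucc : _ →ₐ[A] MvPolynomial (Fin (i+2)) A).toRingHom (X (Fin.last (i+1))) P' := by
        rw [hD, hP', Polynomial.eval₂_map]
        have := Polynomial.hom_eval₂ P (rename Fin.castSucc : _ →ₐ[A] MvPolynomial (Fin (i+1)) A).toRingHom ((rename (fun j : Fin (i + 1) => if j = Fin.last i then Fin.last (i + 1) else j.castSucc)) : _ →ₐ[A] MvPolynomial (Fin (i+2)) A).toRingHom (X (Fin.last i))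
        refine this.trans ?_
        congr 1
        · ext j <;> simp [(Fin.castSucc_lt_last _).ne]
        · simp
      rw [e2, ← k2, e1]
      simp
      ring


/-- substitution of a root of `g` for the first variable -/
noncomputable def phiAux {A : Type*} [CommRing A] (n : ℕ) (g : Polynomial A) :
    MvPolynomial (Fin (n+1)) A →ₐ[A] MvPolynomial (Fin n) (AdjoinRoot g) :=
  (MvPolynomial.mapAlgHom (AdjoinRoot.mkₐ g)).comp
    (((renameEquiv A (_root_.finSuccEquiv n)).trans (optionEquivRight A (Fin n))) : 
      MvPolynomial (Fin (n+1)) A →ₐ[A] MvPolynomial (Fin n) (Polynomial A))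

theorem phiAux_X_zero {A : Type*} [CommRing A] (n : ℕ) (g : Polynomial A) :
    phiAux n g (X 0) = MvPolynomial.C (AdjoinRoot.root g) := by
  simp [phiAux]

theorem phiAux_X_succ {A : Type*} [CommRing A] (n : ℕ) (g : Polynomial A) (i : Fin n) :
    phiAux n g (X i.succ) = X i := by
  simp [phiAux]

theorem phiAux_surj {A : Type*} [CommRing A] (n : ℕ) (g : Polynomial A) :
    Function.Surjective (phiAux n g) := by
  unfold phiAux
  rw [AlgHom.coe_comp]
  refine Function.Surjective.comp ?_ (AlgEquiv.surjective _)
  exact MvPolynomial.map_surjective _ AdjoinRoot.mk_surjective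

theorem equiv_aux {A : Type*} [CommRing A] (n : ℕ) (g : Polynomial A) :
    ((renameEquiv A (_root_.finSuccEquiv n)).trans (optionEquivRight A (Fin n)))
      (Polynomial.aeval (X 0) g) = MvPolynomial.C g := by
  rw [← AlgEquiv.coe_toAlgHom, ← Polynomial.aeval_algHom_apply]
  simp only [AlgEquiv.coe_toAlgHom, AlgEquiv.trans_apply, renameEquiv_apply, rename_X,
    finSuccEquiv_zero, optionEquivRight_X_none]
  have := Polynomial.aeval_algHom_apply (IsScalarTower.toAlgHom A (Polynomial A) (MvPolynomial (Fin n) (Polynomial A))) Polynomial.X g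
  simpa [MvPolynomial.algebraMap_eq] using this

theorem phiAux_ker {A : Type*} [CommRing A] (n : ℕ) (g : Polynomial A) :
    RingHom.ker (phiAux n g) = Ideal.span {Polynomial.aeval (X 0) g} := by
  set e := ((renameEquiv A (_root_.finSuccEquiv n)).trans (optionEquivRight A (Fin n))) with he
  ext x
  have h1 : x ∈ RingHom.ker (phiAux n g) ↔
      e x ∈ RingHom.ker (MvPolynomial.mapAlgHom (σ := Fin n) (AdjoinRoot.mkₐ g)) := Iff.rfl
  have h2 : RingHom.ker (AdjoinRoot.mkₐ g) = Ideal.span {g} := by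
    ext y
    rw [Ideal.mem_span_singleton, ← AdjoinRoot.mk_eq_zero]; rfl
  rw [h1, MvPolynomial.ker_mapAlgHom, h2, Ideal.map_span, Set.image_singleton,
    Ideal.mem_span_singleton, Ideal.mem_span_singleton, ← equiv_aux]
  exact map_dvd_iff e

theorem regular_aux {A : Type*} [CommRing A] (n : ℕ) (g : Polynomial A) (hg : g.Monic)
    (x : MvPolynomial (Fin (n+1)) A) (hx : x * Polynomial.aeval (X 0) g = 0) : x = 0 := by
  set e := ((renameEquiv A (_root_.finSuccEquiv n)).trans (optionEquivRight A (Fin n))) with he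
  have h := congrArg e hx
  rw [map_mul, equiv_aux, map_zero] at h
  apply e.injective
  rw [map_zero]
  ext1 m
  have := congrArg (MvPolynomial.coeff m) h
  rw [mul_comm, MvPolynomial.coeff_C_mul, MvPolynomial.coeff_zero] at this
  rw [MvPolynomial.coeff_zero]
  exact hg.isRegular.left.eq_iff.1 (by simpa using this)

/-- triangular monic system -/
def Tri {A : Type*} [CommRing A] {r : ℕ} (G : Fin r → MvPolynomial (Fin r) A) : Prop :=
  ∀ i, ∃ P : Polynomial (MvPolynomial (Fin r) A), P.Monic ∧ 0 < P.natDegree ∧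
    (∀ k, P.coeff k ∈ Algebra.adjoin A (X '' {j | j < i})) ∧ G i = P.eval (X i)

theorem tower_aux (r : ℕ) : ∀ {A : Type*} [CommRing A] [Nontrivial A]
    (G : Fin r → MvPolynomial (Fin r) A) (_ : Tri G),
    (∀ i : Fin r, ∀ x, x * G i ∈ Ideal.span (G '' {j | j < i}) →
        x ∈ Ideal.span (G '' {j | j < i})) ∧
    Nontrivial (MvPolynomial (Fin r) A ⧸ Ideal.span (Set.range G)) ∧
    Module.Free A (MvPolynomial (Fin r) A ⧸ Ideal.span (Set.range G)) ∧
    Module.Finite A (MvPolynomial (Fin r) A ⧸ Ideal.span (Set.range G)) := by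
  induction r with
  | zero =>
    intro A _ _ G _
    refine ⟨fun i => i.elim0, ?_⟩
    have : Ideal.span (Set.range G) = ⊥ := by simp [Set.range_eq_empty]
    rw [this]
    let e : (MvPolynomial (Fin 0) A ⧸ (⊥ : Ideal (MvPolynomial (Fin 0) A))) ≃ₐ[A] A :=
      (AlgEquiv.quotientBot A _).trans (isEmptyAlgEquiv A (Fin 0))
    exact ⟨e.toEquiv.nontrivial, Module.Free.of_equiv e.symm.toLinearEquiv,
      Module.Finite.equiv e.symm.toLinearEquiv⟩
  | succ n ih =>
    intro A _ _ G hG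
    obtain ⟨g, hgm, hgd, hg0⟩ : ∃ g : Polynomial A, g.Monic ∧ 0 < g.natDegree ∧
        G 0 = Polynomial.aeval (X 0) g := by
      obtain ⟨P, hP, hd, hc, h0⟩ := hG 0
      have : P ∈ Polynomial.lifts (algebraMap A (MvPolynomial (Fin (n+1)) A)) := by
        rw [Polynomial.lifts_iff_coeff_lifts]
        intro k
        have := hc k
        simp only [Fin.not_lt_zero, Set.ofPred_false, Set.image_empty, Algebra.adjoin_empty,
          Algebra.mem_bot] at this
        exact this
      obtain ⟨q, hq, hqd, hqm⟩ := Polynomial.lifts_and_natDegree_eq_and_monic this hP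
      refine ⟨q, hqm, by omega, ?_⟩
      rw [h0, ← hq, Polynomial.eval_map, Polynomial.aeval_def]
    have hnt : Nontrivial (AdjoinRoot g) := by
      refine Ideal.Quotient.nontrivial_iff.2 ?_
      rw [Ne, Ideal.span_singleton_eq_top, hgm.isUnit_iff]
      rintro rfl
      simp at hgd
    have := hgm.free_adjoinRoot
    have := hgm.finite_adjoinRoot
    set φ := phiAux n g with hφ
    have hsurj : Function.Surjective φ := phiAux_surj n g
    have hker : RingHom.ker φ = Ideal.span {G 0} := by rw [hg0, hφ, phiAux_ker]
    have hadj : ∀ i : Fin n, ∀ y ∈ Algebra.adjoin A (X '' {j | j < i.succ}), 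
        φ y ∈ Algebra.adjoin (AdjoinRoot g) (X '' {j : Fin n | j < i}) := by
      intro i y hy
      induction hy using Algebra.adjoin_induction with
      | mem x hx =>
        obtain ⟨j, hj, rfl⟩ := hx
        induction j using Fin.cases with
        | zero => 
          rw [hφ, phiAux_X_zero]
          exact Subalgebra.algebraMap_mem _ _
        | succ j => 
          rw [hφ, phiAux_X_succ]
          exact Algebra.subset_adjoin ⟨j, by simpa using hj, rfl⟩
      | algebraMap a =>
        rw [AlgHom.commutes, IsScalarTower.algebraMap_apply A (AdjoinRoot g)
          (MvPolynomial (Fin n) (AdjoinRoot g))]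
        exact Subalgebra.algebraMap_mem _ _
      | add x y _ _ hx hy => rw [map_add]; exact add_mem hx hy
      | mul x y _ _ hx hy => rw [map_mul]; exact mul_mem hx hy
    have hTri : Tri (fun i : Fin n => φ (G i.succ)) := by
      intro i
      obtain ⟨P, hP, hd, hc, h0⟩ := hG i.succ
      refine ⟨P.map φ.toRingHom, hP.map _, by rwa [hP.natDegree_map], ?_, ?_⟩
      · intro k
        rw [Polynomial.coeff_map]
        exact hadj i _ (hc k)
      · have : X i = φ.toRingHom (X i.succ) := (phiAux_X_succ n g i).symm
        rw [this, Polynomial.eval_map_apply, ← h0]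
        rfl
    obtain ⟨r1, r2, r3, r4⟩ := ih _ hTri
    have hspan : ∀ T : Set (Fin n), Ideal.span (G '' insert 0 (Fin.succ '' T)) =
        (Ideal.span ((fun i : Fin n => φ (G i.succ)) '' T)).comap φ := by
      intro T
      have e1 : (fun i : Fin n => φ (G i.succ)) '' T = φ '' (G '' (Fin.succ '' T)) := by
        simp only [Set.image_image]
      rw [e1, ← Ideal.map_span, Ideal.comap_map_of_surjective φ hsurj, Set.image_insert_eq,
        Ideal.span_insert, sup_comm]
      congr 1
      exact hker.symm
    refine ⟨?_, ?_⟩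
    · intro i x hx
      induction i using Fin.cases with
      | zero => 
        simp only [Fin.not_lt_zero, Set.ofPred_false, Set.image_empty, Ideal.span_empty, Ideal.mem_bot] at hx ⊢
        rw [hg0] at hx
        exact regular_aux n g hgm x hx
      | succ i =>
        have hT : {j | j < i.succ} = insert 0 (Fin.succ '' {j | j < i}) := by
          ext j
          induction j using Fin.cases with
          | zero => simp
          | succ j => simp [Fin.succ_ne_zero]
        rw [hT, hspan] at hx ⊢
        rw [Ideal.mem_comap] at hx ⊢
        rw [map_mul] at hx
        exact r1 i _ hx
    · have hI : Ideal.span (Set.range G) = 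
        (Ideal.span (Set.range (fun i : Fin n => φ (G i.succ)))).comap φ := by
        rw [← Set.image_univ, ← Set.image_univ, ← hspan]
        congr 2
        ext j
        induction j using Fin.cases with
          | zero => simp
          | succ j => simp
      set J := Ideal.span (Set.range (fun i : Fin n => φ (G i.succ))) with hJ
      let ψ : MvPolynomial (Fin (n+1)) A →ₐ[A] (MvPolynomial (Fin n) (AdjoinRoot g) ⧸ J) :=
        (Ideal.Quotient.mkₐ A J).comp φ
      have hψ : Function.Surjective ψ := (Ideal.Quotient.mkₐ_surjective A J).comp hsurj
      have hk : Ideal.span (Set.range G) = RingHom.ker ψ := by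
        rw [hI]
        ext x
        rw [Ideal.mem_comap, RingHom.mem_ker]
        exact Ideal.Quotient.eq_zero_iff_mem.symm
      rw [hk]
      let e := Ideal.quotientKerAlgEquivOfSurjective hψ
      have f1 : Module.Free A (MvPolynomial (Fin n) (AdjoinRoot g) ⧸ J) :=
        Module.Free.trans (S := AdjoinRoot g)
      have f2 : Module.Finite A (MvPolynomial (Fin n) (AdjoinRoot g) ⧸ J) :=
        Module.Finite.trans (AdjoinRoot g) _
      exact ⟨e.toEquiv.nontrivial, Module.Free.of_equiv e.symm.toLinearEquiv,
        Module.Finite.equiv e.symm.toLinearEquiv⟩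

/-- Over an algebraically closed field `K`, for `d-s+1 ≤ r ≤ d`, the divided
differences `G_i = Δ^{i-1}F(B_0, T_1, …, T_i)` (`1 ≤ i ≤ r`) of
`F = T^d + ∑_{i=d-s}^{d-1} a_i T^i + ∑_{i=1}^{d-s-1} B_i T^i + B_0` form a regular sequence in
`K[B_{d-s-1},…,B_0, T_1,…,T_r]` (the first is nonzero, and each is a nonzerodivisor modulo the
ideal generated by the previous ones), and the affine variety they define is equidimensional of
dimension `d - s`: every minimal prime over the ideal they generate has quotient of Krull
dimension `d - s`. -/
theorem stmt_13 {K : Type*} [Field K] [IsAlgClosed K] (d s r : ℕ)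
    (hs : 1 ≤ s) (hsd : s ≤ d) (hr1 : d - s + 1 ≤ r) (hr2 : r ≤ d)
    (a : Fin s → K)
    (F : Polynomial (MvPolynomial (Fin (d - s)) K))
    (hF : F = Polynomial.X ^ d
        + (∑ j : Fin s, Polynomial.C (MvPolynomial.C (a j)) * Polynomial.X ^ (d - s + (j : ℕ)))
        + ∑ i : Fin (d - s), Polynomial.C (MvPolynomial.X i) * Polynomial.X ^ (i : ℕ))
    (Δ : (i : ℕ) → MvPolynomial (Fin (i + 1)) (MvPolynomial (Fin (d - s)) K))
    (hΔ : IsDividedDifferenceFamily F Δ)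
    (G : Fin r → MvPolynomial (Fin r) (MvPolynomial (Fin (d - s)) K))
    (hG : ∀ i : Fin r, G i = MvPolynomial.rename (Fin.castLE i.isLt) (Δ i)) :
    (∀ i : Fin r, ∀ x, x * G i ∈ Ideal.span (G '' {j | j < i}) →
        x ∈ Ideal.span (G '' {j | j < i})) ∧
    Ideal.span (Set.range G) ≠ ⊤ ∧
    ∀ p ∈ (Ideal.span (Set.range G)).minimalPrimes,
      ringKrullDim (MvPolynomial (Fin r) (MvPolynomial (Fin (d - s)) K) ⧸ p)
        = ((d - s : ℕ) : WithBot (WithTop ℕ)) := by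
  have hmon : F.Monic ∧ F.natDegree = d := by
    have hdeg : ((∑ j : Fin s, Polynomial.C (MvPolynomial.C (a j)) * Polynomial.X ^ (d - s + (j : ℕ)))
        + ∑ i : Fin (d - s), Polynomial.C (MvPolynomial.X i) * Polynomial.X ^ (i : ℕ) :
        Polynomial (MvPolynomial (Fin (d - s)) K)).degree < d := by
      refine lt_of_le_of_lt (Polynomial.degree_add_le _ _) (max_lt ?_ ?_)
      · rw [← Polynomial.mem_degreeLT]
        refine Submodule.sum_mem _ fun j _ => ?_
        rw [Polynomial.mem_degreeLT]
        refine lt_of_le_of_lt (Polynomial.degree_C_mul_X_pow_le _ _) ?_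
        have := j.isLt
        exact_mod_cast (by omega : d - s + (j : ℕ) < d)
      · rw [← Polynomial.mem_degreeLT]
        refine Submodule.sum_mem _ fun j _ => ?_
        rw [Polynomial.mem_degreeLT]
        refine lt_of_le_of_lt (Polynomial.degree_C_mul_X_pow_le _ _) ?_
        have := j.isLt
        exact_mod_cast (by omega : (j : ℕ) < d)
    rw [add_assoc] at hF
    rw [hF]
    refine ⟨Polynomial.monic_X_pow_add hdeg, ?_⟩
    rw [Polynomial.natDegree_add_eq_left_of_degree_lt (by simpa using hdeg),
      Polynomial.natDegree_X_pow]
  have hTri : Tri G := by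
    intro i
    have hi := i.isLt
    obtain ⟨P, hP, hd, hD⟩ := dd_aux F hmon.1 Δ hΔ.1 hΔ.2 i (by omega)
    refine ⟨P.map (rename (fun j : Fin (i : ℕ) => (⟨j, j.isLt.trans hi⟩ : Fin r)) :
      _ →ₐ[MvPolynomial (Fin (d - s)) K] MvPolynomial (Fin r) _).toRingHom, hP.map _, ?_, ?_, ?_⟩
    · rw [hP.natDegree_map]; omega
    · intro k
      rw [Polynomial.coeff_map]
      induction P.coeff k using MvPolynomial.induction_on with
      | C a =>
        simp only [AlgHom.toRingHom_eq_coe, RingHom.coe_coe, rename_C]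
        exact Subalgebra.algebraMap_mem _ _
      | add p q hp hq => rw [map_add]; exact add_mem hp hq
      | mul_X p j hp =>
        rw [map_mul]
        refine mul_mem hp (Algebra.subset_adjoin ⟨⟨j, j.isLt.trans hi⟩, ?_, ?_⟩)
        · exact j.isLt
        · simp
    · rw [hG, hD, Polynomial.eval_map]
      refine (Polynomial.hom_eval₂ P _ (rename (Fin.castLE i.isLt) :
        _ →ₐ[MvPolynomial (Fin (d - s)) K] MvPolynomial (Fin r) _).toRingHom _).trans ?_
      congr 1
      · ext j <;> simp <;> rfl
      · simp; rfl
  obtain ⟨r1, r2, r3, r4⟩ := tower_aux r G hTri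
  refine ⟨r1, Ideal.Quotient.nontrivial_iff.1 r2, fun p hp => ?_⟩
  rw [dim_aux (A := MvPolynomial (Fin (d - s)) K) _ p hp, MvPolynomial.ringKrullDim_of_isNoetherianRing, ringKrullDim_eq_zero_of_field]
  rw [zero_add, Nat.card_eq_fintype_card, Fintype.card_fin]
  rfl
end
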